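/- arXiv:2005.02896 — 2 statements merged into one kernel-verified Lean document; each statement's English description precedes it below -/
import Mathlib

section
/- Let G be a hole-with-hat-free graph. Let C, D be disjoint subsets of V(G), complete to each other, such that C is connected. Let P be a connected induced subgraph of G\(C ∪ D) such that some vertex of P has a neighbour in C and no vertex of P is complete to C. Then for every v ∈ V(P) there exists u ∈ V(P), mixed on C, such that every vertex of D adjacent to v is also adjacent to u. -/
open Finset

namespace EHhat

variable {V : Type*}

/-- `c : ZMod n → V` describes a hole (induced cycle of length `n ≥ 4`) in `G`. -/
def IsHole (G : SimpleGraph V) (n : ℕ) (c : ZMod n → V) : Prop :=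
  4 ≤ n ∧ Function.Injective c ∧
    ∀ i j : ZMod n, G.Adj (c i) (c j) ↔ (i - j = 1 ∨ j - i = 1)

/-- `G` contains a hole together with a hat: a vertex outside the hole with exactly
two neighbours on the hole, and these two neighbours are adjacent (consecutive). -/
def HasHoleWithHat (G : SimpleGraph V) : Prop :=
  ∃ (n : ℕ) (c : ZMod n → V) (v : V) (i : ZMod n),
    IsHole G n c ∧ (∀ j, v ≠ c j) ∧ (∀ j, G.Adj v (c j) ↔ (j = i ∨ j = i + 1))

def HoleWithHatFree (G : SimpleGraph V) : Prop := ¬ HasHoleWithHat G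

/-- A graph is perfect if chromatic number equals clique number for
every induced subgraph. -/
def IsPerfect [Fintype V] (G : SimpleGraph V) : Prop :=
  ∀ S : Finset V,
    (G.induce (S : Set V)).chromaticNumber = ((G.induce (S : Set V)).cliqueNum : ℕ∞)

/-- `f` is a good function on `G`: it is nonnegative and sums to at most 1 on
every perfect induced subgraph of `G`. -/
def GoodOn [Fintype V] (G : SimpleGraph V) (f : V → ℝ) : Prop :=
  (∀ v, 0 ≤ f v) ∧
  ∀ S : Finset V, IsPerfect (G.induce (S : Set V)) → ∑ v ∈ S, f v ≤ 1

/-- `G` is `α`-narrow if `∑ v, f v ^ α ≤ 1` for every good function `f` on `G`. -/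
def Narrow [Fintype V] (G : SimpleGraph V) (α : ℝ) : Prop :=
  ∀ f : V → ℝ, GoodOn G f → ∑ v, f v ^ α ≤ 1

/-- `(G, f)` is an `α`-critical pair. -/
def Critical [Fintype V] (G : SimpleGraph V) (f : V → ℝ) (α : ℝ) : Prop :=
  GoodOn G f ∧
  (∀ S : Finset V, S ≠ Finset.univ → Narrow (G.induce (S : Set V)) α) ∧
  1 < ∑ v, f v ^ α

/-- `A` is complete to `B`. -/
def CompleteTo (G : SimpleGraph V) (A B : Set V) : Prop :=
  ∀ a ∈ A, ∀ b ∈ B, G.Adj a b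

/-- `A` is anticomplete to `B`. -/
def AnticompleteTo (G : SimpleGraph V) (A B : Set V) : Prop :=
  ∀ a ∈ A, ∀ b ∈ B, ¬ G.Adj a b

/-- The vertex `v` is complete to the set `C`. -/
def VertCompleteTo (G : SimpleGraph V) (v : V) (C : Set V) : Prop :=
  ∀ c ∈ C, G.Adj v c

/-- The vertex `v` is mixed on `C`: it has both a neighbour and a non-neighbour in `C`. -/
def MixedOn (G : SimpleGraph V) (v : V) (C : Set V) : Prop :=
  (∃ c ∈ C, G.Adj v c) ∧ (∃ c ∈ C, ¬ G.Adj v c)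

/-- `X ⊆ V(G)` is connected: `G[X]` is a connected graph. -/
def ConnSet (G : SimpleGraph V) (X : Set V) : Prop :=
  (G.induce X).Connected

/-- `X ⊆ V(G)` is anticonnected: the complement of `G[X]` is a connected graph. -/
def AnticonnSet (G : SimpleGraph V) (X : Set V) : Prop :=
  ((G.induce X)ᶜ).Connected

/-- The sum of `f` over a set `X` of vertices. -/
noncomputable def setSum [Fintype V] (f : V → ℝ) (X : Set V) : ℝ :=
  ∑ v, X.indicator f v

/-- `w` is a weight function making `(G, w)` a weighted graph. -/
def IsWeight [Fintype V] (w : V → ℝ) : Prop :=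
  (∀ v, 0 ≤ w v) ∧ ∑ v, w v = 1

/-- The weighted graph `(G, w)` is `ε`-coherent. -/
def Coherent [Fintype V] (G : SimpleGraph V) (w : V → ℝ) (ε : ℝ) : Prop :=
  (∀ v, w v < ε) ∧
  (∀ v, setSum w (G.neighborSet v) < ε) ∧
  ∀ A B : Set V, Disjoint A B → AnticompleteTo G A B →
    min (setSum w A) (setSum w B) < ε

/-- `Y` is (the vertex set of) a component of `G[X]`: a maximal connected subset of `X`. -/
def IsCompOf (G : SimpleGraph V) (X Y : Set V) : Prop :=
  Y ⊆ X ∧ ConnSet G Y ∧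
  ∀ Z : Set V, Y ⊆ Z → Z ⊆ X → ConnSet G Z → Z = Y

/-- `Y` is the big component of `G[X]` (with respect to the weight `w` and `ε`). -/
def IsBigComp [Fintype V] (G : SimpleGraph V) (w : V → ℝ) (ε : ℝ) (X Y : Set V) : Prop :=
  IsCompOf G X Y ∧ setSum w X - ε < setSum w Y

/-- `v` is an attachment of `A`: a vertex outside `A` with a neighbour in `A`. -/
def IsAttachment (G : SimpleGraph V) (A : Set V) (v : V) : Prop :=
  v ∉ A ∧ ∃ a ∈ A, G.Adj v a

/-- `(C, D)` is a split of the weighted graph `(G, w)`. -/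
def IsSplit [Fintype V] (G : SimpleGraph V) (w : V → ℝ) (ε : ℝ) (C D : Set V) : Prop :=
  Disjoint C D ∧ 2 ≤ C.ncard ∧ ConnSet G C ∧ AnticonnSet G C ∧
  D.Nonempty ∧ D = {v | v ∉ C ∧ ∀ c ∈ C, G.Adj v c} ∧
  ∀ Y : Set V, IsBigComp G w ε ((C ∪ D)ᶜ) Y → ∀ c ∈ C, ¬ IsAttachment G Y c

/-- A split is optimal if its first part is maximal among splits. -/
def IsOptimalSplit [Fintype V] (G : SimpleGraph V) (w : V → ℝ) (ε : ℝ) (C D : Set V) : Prop :=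
  IsSplit G w ε C D ∧ ∀ C' D' : Set V, IsSplit G w ε C' D' → C ⊆ C' → C' = C

/-- `(A, C, D, B)` is a fracture of `(G, w)`: `(C, D)` is an optimal split, `A` is the union
of the components of `G \ (C ∪ D)` with an attachment in `C`, and `B` is the rest. -/
def IsFracture [Fintype V] (G : SimpleGraph V) (w : V → ℝ) (ε : ℝ)
    (A C D B : Set V) : Prop :=
  IsOptimalSplit G w ε C D ∧
  A = {v | ∃ Y : Set V, IsCompOf G ((C ∪ D)ᶜ) Y ∧ v ∈ Y ∧ ∃ c ∈ C, IsAttachment G Y c} ∧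
  B = ((C ∪ D)ᶜ : Set V) \ A

/-- The generating relation for the forcer graph: vertices `0,1,2,3` and `4,5,6,7`
each induce a path, and the two quadruples are complete to each other. -/
def forcerRel (i j : Fin 8) : Prop :=
  (i.val < 4 ∧ 4 ≤ j.val) ∨ j.val = i.val + 1

/-- The forcer graph. -/
def forcer : SimpleGraph (Fin 8) := SimpleGraph.fromRel forcerRel

def ForcerFree (G : SimpleGraph V) : Prop := IsEmpty (forcer ↪g G)

/-- Given an embedded copy of the forcer via the vertex map `f`, one of its two
constituent paths has all its vertices in `S`. -/
def ConstituentPathIn (f : Fin 8 → V) (S : Set V) : Prop :=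
  (∀ i : Fin 8, i.val < 4 → f i ∈ S) ∨ (∀ i : Fin 8, 4 ≤ i.val → f i ∈ S)

/-- `X` is a homogeneous set of `H`. -/
def IsHomogeneousSet {W : Type*} (H : SimpleGraph W) (X : Set W) : Prop :=
  ∀ v ∉ X, (∀ x ∈ X, H.Adj v x) ∨ (∀ x ∈ X, ¬ H.Adj v x)

/-- `H` is guarded: for each forcer in `H` there is a proper homogeneous set
containing a constituent path of the forcer. -/
def Guarded {W : Type*} (H : SimpleGraph W) : Prop :=
  ∀ f : forcer ↪g H, ∃ X : Set W,
    X ≠ Set.univ ∧ IsHomogeneousSet H X ∧ ConstituentPathIn (fun i => f i) X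

/-- The house: the complement of the five-vertex path. -/
def house : SimpleGraph (Fin 5) := (SimpleGraph.pathGraph 5)ᶜ

def HouseFree (G : SimpleGraph V) : Prop := IsEmpty (house ↪g G)

/-- `g` is a good function on the induced subgraph `G[X]`. -/
def GoodOnSub [Fintype V] (G : SimpleGraph V) (X : Set V) (g : V → ℝ) : Prop :=
  (∀ v ∈ X, 0 ≤ g v) ∧
  ∀ S : Finset V, (S : Set V) ⊆ X → IsPerfect (G.induce (S : Set V)) →
    ∑ v ∈ S, g v ≤ 1


/-- Two residues differ by one iff their representatives are cyclically consecutive. -/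
theorem zmod_sub_eq_one_iff {n : ℕ} (hn : 2 ≤ n) (i j : ZMod n) :
    i - j = 1 ↔ i.val = j.val + 1 ∨ (i.val = 0 ∧ j.val + 1 = n) := by
  have : NeZero n := ⟨by omega⟩
  have : Fact (1 < n) := ⟨by omega⟩
  have hi := i.val_lt
  have hj := j.val_lt
  rw [sub_eq_iff_eq_add', ← (ZMod.val_injective n).eq_iff, ZMod.val_add, ZMod.val_one]
  rcases (show j.val + 1 < n ∨ j.val + 1 = n by omega) with h | h
  · rw [Nat.mod_eq_of_lt h]
    omega
  · rw [h, Nat.mod_self]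
    omega

/-- A hole with a hat given by a sequence: the hole is `f 0, …, f (n - 1)` and the hat is adjacent
to exactly `f 0` and `f 1`. -/
theorem hasHoleWithHat_of_nat {V : Type*} {G : SimpleGraph V} {n : ℕ} (hn : 4 ≤ n)
    (f : ℕ → V) (v : V)
    (hinj : ∀ a b, a < b → b < n → f a ≠ f b)
    (hadj : ∀ a b, a < b → b < n → (G.Adj (f a) (f b) ↔ b = a + 1 ∨ (a = 0 ∧ b + 1 = n)))
    (hv : ∀ a < n, v ≠ f a) (hvadj : ∀ a < n, (G.Adj v (f a) ↔ a = 0 ∨ a = 1)) :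
    HasHoleWithHat G := by
  have : NeZero n := ⟨by omega⟩
  have : Fact (1 < n) := ⟨by omega⟩
  refine ⟨n, fun i => f i.val, v, 0, ⟨hn, ?_, ?_⟩, fun j => hv _ j.val_lt, ?_⟩
  · intro i j hij
    apply ZMod.val_injective n
    rcases lt_trichotomy i.val j.val with h | h | h
    · exact absurd hij (hinj _ _ h j.val_lt)
    · exact h
    · exact absurd hij.symm (hinj _ _ h i.val_lt)
  · intro i j
    have hi := i.val_lt
    have hj := j.val_lt
    rw [zmod_sub_eq_one_iff (by omega), zmod_sub_eq_one_iff (by omega)]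
    rcases lt_trichotomy i.val j.val with h | h | h
    · rw [hadj _ _ h hj]
      omega
    · simp only [h, SimpleGraph.irrefl, false_iff]
      omega
    · rw [G.adj_comm, hadj _ _ h hi]
      omega
  · intro j
    rw [hvadj _ j.val_lt, zero_add, ZMod.val_eq_zero, ← ZMod.val_one n,
      (ZMod.val_injective n).eq_iff]

/-- A vertex mixed on a connected set is mixed on some edge of it. -/
theorem MixedOn.exists_adj {V : Type*} {G : SimpleGraph V} {u : V} {C : Set V}
    (hu : MixedOn G u C) (hC : ConnSet G C) :
    ∃ a ∈ C, ∃ b ∈ C, G.Adj a b ∧ G.Adj u a ∧ ¬ G.Adj u b := by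
  obtain ⟨⟨a, ha, hua⟩, b, hb, hub⟩ := hu
  obtain ⟨w⟩ := hC.preconnected ⟨a, ha⟩ ⟨b, hb⟩
  obtain ⟨e, -, h₁, h₂⟩ := w.exists_boundary_dart {x | G.Adj u x} hua hub
  exact ⟨e.fst, e.fst.2, e.snd, e.snd.2, e.adj, h₁, h₂⟩

/-- In a connected graph, a vertex is joined to a nearest vertex satisfying a given predicate by an
induced path, none of whose earlier vertices satisfies the predicate. -/
theorem exists_induced_path_to {W : Type*} {H : SimpleGraph W} (hH : H.Connected) (v : W)
    (S : W → Prop) (hS : ∃ u, S u) :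
    ∃ (L : ℕ) (p : ℕ → W), p 0 = v ∧ S (p L) ∧ (∀ i < L, ¬ S (p i)) ∧
      (∀ i j, i < j → j ≤ L → p i ≠ p j) ∧
      ∀ i j, i < j → j ≤ L → (H.Adj (p i) (p j) ↔ j = i + 1) := by
  obtain ⟨u, hu, hmin⟩ := WellFounded.has_min (measure (H.dist v)).wf {u | S u} hS
  obtain ⟨w, hw⟩ := hH.exists_walk_length_eq_dist v u
  have hd : ∀ i ≤ w.length, H.dist v (w.getVert i) = i := by
    intro i hi
    have h₁ := SimpleGraph.dist_le (w.take i)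
    have h₂ := SimpleGraph.dist_le (w.drop i)
    have h₃ := hH.dist_triangle (u := v) (v := w.getVert i) (w := u)
    rw [SimpleGraph.Walk.take_length] at h₁
    rw [SimpleGraph.Walk.drop_length] at h₂
    omega
  refine ⟨w.length, w.getVert, w.getVert_zero, by simpa using hu, ?_, ?_, ?_⟩
  · intro i hi hSi
    refine hmin _ hSi ?_
    change H.dist v (w.getVert i) < H.dist v u
    rw [hd i hi.le]
    omega
  · intro i j hij hj h
    have hi' := hd i (by omega)
    rw [h, hd j hj] at hi'
    omega
  · intro i j hij hj
    constructor
    · intro h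
      have h₃ := hH.dist_triangle (u := v) (v := w.getVert i) (w := w.getVert j)
      rw [SimpleGraph.dist_eq_one_iff_adj.mpr h, hd i (by omega), hd j hj] at h₃
      omega
    · rintro rfl
      exact w.adj_getVert_succ (by omega)

theorem statement_5 {V : Type} [Fintype V] (G : SimpleGraph V)
    (hG : HoleWithHatFree G) (C D : Set V) (hdisj : Disjoint C D)
    (hcomp : CompleteTo G C D) (hCconn : ConnSet G C)
    (P : Set V) (hP : P ⊆ (C ∪ D)ᶜ) (hPconn : ConnSet G P)
    (hattach : ∃ p ∈ P, ∃ c ∈ C, G.Adj p c)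
    (hnotcomp : ∀ p ∈ P, ¬ VertCompleteTo G p C) :
    ∀ v ∈ P, ∃ u ∈ P, MixedOn G u C ∧ ∀ d ∈ D, G.Adj d v → G.Adj d u := by
  intro v hv
  have hnadj : ∀ p ∈ P, ¬ MixedOn G p C → ∀ c ∈ C, ¬ G.Adj p c := by
    intro p hp hm c hc hpc
    refine hnotcomp p hp fun c' hc' => ?_
    by_contra h
    exact hm ⟨⟨c, hc, hpc⟩, c', hc', h⟩
  have hmixed : ∃ u : P, MixedOn G (u : V) C := by
    by_contra! h
    obtain ⟨p, hp, c, hc, hpc⟩ := hattach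
    exact hnadj p hp (h ⟨p, hp⟩) c hc hpc
  obtain ⟨L, q, hq0, hqL, hqm, hqinj, hqadj⟩ :=
    exists_induced_path_to hPconn ⟨v, hv⟩ (fun u => MixedOn G (u : V) C) hmixed
  refine ⟨q L, (q L).2, hqL, fun d hd hdv => ?_⟩
  by_contra hdL
  obtain ⟨a, ha, b, hb, hab, hLa, hLb⟩ := hqL.exists_adj hCconn
  obtain ⟨i, hiL, hdi, hlast⟩ : ∃ i < L, G.Adj d (q i) ∧
      ∀ j, i < j → j ≤ L → ¬ G.Adj d (q j) := by
    classical
    have h0 : G.Adj d (q 0) := by rw [hq0]; exact hdv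
    have hs := Nat.findGreatest_spec (P := fun j => G.Adj d (q j)) (Nat.zero_le L) h0
    refine ⟨_, lt_of_le_of_ne (Nat.findGreatest_le L) fun h => hdL ?_, hs,
      fun j h₁ h₂ => Nat.findGreatest_is_greatest h₁ h₂⟩
    rwa [h] at hs
  have hqC : ∀ j, (q j : V) ∉ C := fun j h => hP (q j).2 (Or.inl h)
  have hqD : ∀ j, (q j : V) ∉ D := fun j h => hP (q j).2 (Or.inr h)
  have hCD : ∀ c ∈ C, c ∉ D := fun c h h' => Set.disjoint_left.mp hdisj h h'
  have hqa : ∀ j < L, ¬ G.Adj (q j) a := fun j hj => hnadj _ (q j).2 (hqm j hj) a ha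
  have hqb : ∀ j ≤ L, ¬ G.Adj (q j) b := by
    intro j hj
    rcases hj.lt_or_eq with hj | rfl
    · exact hnadj _ (q j).2 (hqm j hj) b hb
    · exact hLb
  refine hG (hasHoleWithHat_of_nat (n := L - i + 3) (by omega)
    (fun k => match k with
      | 0 => a
      | 1 => d
      | k + 2 => (q (i + k) : V)) b ?_ ?_ ?_ ?_)
  · rintro (_ | _ | x) (_ | _ | y) hxy hy <;> try omega
    · exact fun h : a = d => hCD a ha (h ▸ hd)
    · exact fun h : a = q (i + y) => hqC _ (h ▸ ha)
    · exact fun h : d = q (i + y) => hqD _ (h ▸ hd)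
    · exact fun h => hqinj (i + x) (i + y) (by omega) (by omega) (Subtype.ext h)
  · rintro (_ | _ | x) (_ | _ | y) hxy hy <;> try omega
    · simpa using hcomp a ha d hd
    · change G.Adj a (q (i + y)) ↔ _
      rw [G.adj_comm]
      rcases (show i + y < L ∨ i + y = L by omega) with h | h
      · exact iff_of_false (hqa _ h) (by omega)
      · rw [h]
        exact iff_of_true hLa (by omega)
    · change G.Adj d (q (i + y)) ↔ _
      rcases Nat.eq_zero_or_pos y with rfl | h
      · exact iff_of_true hdi (by omega)
      · exact iff_of_false (hlast _ (by omega) (by omega)) (by omega)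
    · refine (hqadj (i + x) (i + y) (by omega) (by omega)).trans ?_
      omega
  · rintro (_ | _ | x) hx
    · exact hab.ne'
    · exact fun h => hCD b hb (h ▸ hd)
    · exact fun h => hqC _ (h ▸ hb)
  · rintro (_ | _ | x) hx
    · simpa using hab.symm
    · simpa using hcomp b hb d hd
    · exact iff_of_false (fun h => hqb _ (by omega) h.symm) (by omega)

end EHhat
end

section
/- Let G be a hole-with-hat-free graph. Let C, D be disjoint nonempty subsets of V(G), complete to each other, such that C is connected and anticonnected, and D is connected and anticonnected. Then there do not exist connected induced subgraphs P, Q of G\(C ∪ D), with V(P) ∩ V(Q) ≠ ∅, such that: some vertex of P has a neighbour in C and no vertex of P is complete to C; and some vertex of Q has a neighbour in D and no vertex of Q is complete to D. -/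
open Finset

namespace EHhat

variable {V : Type*}

lemma zmod_sub_eq_one_iff_val {N : ℕ} (hN : 2 ≤ N) (i j : ZMod N) :
    i - j = 1 ↔ i.val = j.val + 1 ∨ (i.val = 0 ∧ j.val + 1 = N) := by
  have : NeZero N := ⟨by omega⟩
  have : Fact (1 < N) := ⟨hN⟩
  have hi := i.val_lt
  have hj := j.val_lt
  rw [sub_eq_iff_eq_add', ← (ZMod.val_injective N).eq_iff]
  rcases Nat.lt_or_ge (j.val + 1) N with h | h
  · rw [ZMod.val_add_of_lt (by rwa [ZMod.val_one]), ZMod.val_one]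
    omega
  · rw [ZMod.val_add_of_le (by rwa [ZMod.val_one]), ZMod.val_one]
    omega

/-- A hole with hat described by a sequence indexed by natural numbers. -/
lemma HasHoleWithHat.of_nat {G : SimpleGraph V} {N t : ℕ} (hN : 4 ≤ N) (ht : t + 1 < N)
    (g : ℕ → V) (v : V) (hinj : ∀ a b, a < b → b < N → g a ≠ g b)
    (hadj : ∀ a b, a < b → b < N → (G.Adj (g a) (g b) ↔ b = a + 1 ∨ (a = 0 ∧ b + 1 = N)))
    (hv : ∀ a, a < N → v ≠ g a)
    (hvadj : ∀ a, a < N → (G.Adj v (g a) ↔ a = t ∨ a = t + 1)) :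
    HasHoleWithHat G := by
  have : NeZero N := ⟨by omega⟩
  refine ⟨N, fun i => g i.val, v, (t : ZMod N), ⟨hN, ?_, ?_⟩, fun j => hv _ j.val_lt, ?_⟩
  · intro i j hij
    apply ZMod.val_injective N
    have hi := i.val_lt
    have hj := j.val_lt
    rcases lt_trichotomy i.val j.val with h | h | h
    · exact absurd hij (hinj _ _ h hj)
    · exact h
    · exact absurd hij.symm (hinj _ _ h hi)
  · intro i j
    have hi := i.val_lt
    have hj := j.val_lt
    rw [zmod_sub_eq_one_iff_val (by omega), zmod_sub_eq_one_iff_val (by omega)]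
    rcases lt_trichotomy i.val j.val with h | h | h
    · rw [hadj _ _ h hj]
      omega
    · simp only [h, SimpleGraph.irrefl, false_iff]
      omega
    · rw [G.adj_comm, hadj _ _ h hi]
      omega
  · intro j
    have hj := j.val_lt
    have htv : ((t : ZMod N)).val = t := ZMod.val_cast_of_lt (by omega)
    rw [hvadj _ hj, ← sub_eq_iff_eq_add', zmod_sub_eq_one_iff_val (by omega),
      ← (ZMod.val_injective N).eq_iff, htv]
    omega

/-- An induced path closed up to a hole by an edge `cd`, with a hat on that edge. -/
lemma HasHoleWithHat.of_path {G : SimpleGraph V} {m : ℕ} (hm : 1 ≤ m) (f : ℕ → V) (c d e : V)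
    (hcd : G.Adj c d) (hce : G.Adj c e) (hde : G.Adj d e)
    (hf : ∀ a b, a < b → b ≤ m → (G.Adj (f a) (f b) ↔ b = a + 1))
    (hc : ∀ a, a ≤ m → (G.Adj c (f a) ↔ a = 0))
    (hd : ∀ a, a ≤ m → (G.Adj d (f a) ↔ a = m))
    (he : ∀ a, a ≤ m → ¬ G.Adj e (f a)) :
    HasHoleWithHat G := by
  have hcf : ∀ a, a ≤ m → c ≠ f a := fun a ha h => he a ha (h ▸ hce.symm)
  have hdf : ∀ a, a ≤ m → d ≠ f a := fun a ha h => he a ha (h ▸ hde.symm)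
  have hef : ∀ a, a ≤ m → e ≠ f a := by
    intro a ha h
    have h1 := (hc a ha).1 (h ▸ hce)
    have h2 := (hd a ha).1 (h ▸ hde)
    omega
  have hinj : ∀ a b, a < b → b ≤ m → f a ≠ f b := by
    intro a b hab hb h
    rcases Nat.lt_or_ge b m with hbm | hbm
    · have h1 := (hf b (b + 1) (by omega) (by omega)).2 rfl
      rw [← h, hf a (b + 1) (by omega) (by omega)] at h1
      omega
    · have h1 := (hd b hb).2 (by omega)
      rw [← h, hd a (by omega)] at h1
      omega
  have key : ∀ a, a < m + 3 → a ≤ m ∨ a = m + 1 ∨ a = m + 2 := fun a _ => by omega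
  let g : ℕ → V := fun a => if a ≤ m then f a else if a = m + 1 then d else c
  have g0 : ∀ a, a ≤ m → g a = f a := fun a ha => by simp [g, ha]
  have g1 : g (m + 1) = d := by simp [g]
  have g2 : g (m + 2) = c := by simp [g]
  refine HasHoleWithHat.of_nat (N := m + 3) (t := m + 1) (by omega) (by omega) g e ?_ ?_ ?_ ?_
  · intro a b hab hb
    rcases key b hb with h | rfl | rfl
    · rw [g0 a (by omega), g0 b h]
      exact hinj a b hab h
    · rw [g0 a (by omega), g1]
      exact (hdf a (by omega)).symm
    · rcases key a (by omega) with h | rfl | rfl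
      · rw [g0 a h, g2]
        exact (hcf a h).symm
      · rw [g1, g2]
        exact hcd.ne'
      · omega
  · intro a b hab hb
    rcases key b hb with h | rfl | rfl
    · rw [g0 a (by omega), g0 b h, hf a b hab h]
      omega
    · rw [g0 a (by omega), g1, G.adj_comm, hd a (by omega)]
      omega
    · rcases key a (by omega) with h | rfl | rfl
      · rw [g0 a h, g2, G.adj_comm, hc a h]
        omega
      · rw [g1, g2]
        simp [hcd.symm]
      · omega
  · intro a ha
    rcases key a ha with h | rfl | rfl
    · rw [g0 a h]
      exact hef a h
    · rw [g1]
      exact hde.ne'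
    · rw [g2]
      exact hce.ne'
  · intro a ha
    rcases key a ha with h | rfl | rfl
    · rw [g0 a h]
      simp only [he a h, false_iff]
      omega
    · rw [g1]
      simp [hde.symm]
    · rw [g2]
      simp [hce.symm]

lemma anticonnSet_iff {G : SimpleGraph V} {X : Set V} : AnticonnSet G X ↔ ConnSet Gᶜ X := by
  have : (G.induce X)ᶜ = Gᶜ.induce X := by
    ext a b
    simp [Subtype.ext_iff]
  rw [AnticonnSet, ConnSet, this]

lemma ConnSet.exists_adj_boundary {G : SimpleGraph V} {X S : Set V} (hX : ConnSet G X)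
    (h1 : ∃ x ∈ X, x ∈ S) (h2 : ∃ x ∈ X, x ∉ S) :
    ∃ x ∈ X, ∃ y ∈ X, x ∈ S ∧ y ∉ S ∧ G.Adj x y := by
  obtain ⟨x, hx, hxS⟩ := h1
  obtain ⟨y, hy, hyS⟩ := h2
  obtain ⟨w⟩ := hX.preconnected ⟨x, hx⟩ ⟨y, hy⟩
  obtain ⟨e, -, he1, he2⟩ := w.exists_boundary_dart (Subtype.val ⁻¹' S) hxS hyS
  exact ⟨e.fst, e.fst.2, e.snd, e.snd.2, he1, he2, e.adj⟩

lemma ConnSet.insert {G : SimpleGraph V} {X : Set V} {v x : V} (hX : ConnSet G X)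
    (hx : x ∈ X) (hv : G.Adj v x) : ConnSet G (insert v X) := by
  have hs : (G.induce {v}).Preconnected := by
    rintro ⟨a, rfl⟩ ⟨b, rfl⟩
    exact SimpleGraph.Reachable.refl _
  exact SimpleGraph.connected_induce_union hs hX.preconnected rfl hx hv

lemma ConnSet.exists_seq {G : SimpleGraph V} {X : Set V} {x y : V} (hX : ConnSet G X)
    (hx : x ∈ X) (hy : y ∈ X) :
    ∃ (n : ℕ) (f : ℕ → V), f 0 = x ∧ f n = y ∧ (∀ i, f i ∈ X) ∧
      ∀ i, i < n → G.Adj (f i) (f (i + 1)) := by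
  obtain ⟨w⟩ := hX.preconnected ⟨x, hx⟩ ⟨y, hy⟩
  exact ⟨w.length, fun i => w.getVert i, by simp, by simp, fun i => (w.getVert i).2,
    fun i hi => w.adj_getVert_succ hi⟩

lemma MixedOn.exists_adj_s8 {G : SimpleGraph V} {X : Set V} {v : V} (hv : MixedOn G v X)
    (hX : ConnSet G X) : ∃ x ∈ X, ∃ y ∈ X, G.Adj v x ∧ ¬ G.Adj v y ∧ G.Adj x y :=
  hX.exists_adj_boundary (S := {x | G.Adj v x}) hv.1 hv.2

lemma MixedOn.exists_not_adj {G : SimpleGraph V} {X : Set V} {v : V} (hv : MixedOn G v X)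
    (hX : AnticonnSet G X) :
    ∃ x ∈ X, ∃ y ∈ X, G.Adj v x ∧ ¬ G.Adj v y ∧ x ≠ y ∧ ¬ G.Adj x y := by
  obtain ⟨x, hx, y, hy, h1, h2, h3⟩ :=
    (anticonnSet_iff.1 hX).exists_adj_boundary (S := {x | G.Adj v x}) hv.1 hv.2
  exact ⟨x, hx, y, hy, h1, h2, ((SimpleGraph.compl_adj _ _ _).1 h3).1,
    ((SimpleGraph.compl_adj _ _ _).1 h3).2⟩

lemma MixedOn.of_adj {G : SimpleGraph V} {X : Set V} {v x : V} (hx : x ∈ X) (h : G.Adj v x)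
    (hv : ¬ VertCompleteTo G v X) : MixedOn G v X := by
  refine ⟨⟨x, hx, h⟩, ?_⟩
  simpa [VertCompleteTo] using hv

/-- No vertex outside two anticonnected sets complete to each other is mixed on both. -/
lemma HoleWithHatFree.not_mixedOn_both {G : SimpleGraph V} (hG : HoleWithHatFree G)
    {C D : Set V} (hcomp : CompleteTo G C D) (hC : AnticonnSet G C) (hD : AnticonnSet G D)
    {v : V} (hvC : v ∉ C) (hvD : v ∉ D) (h1 : MixedOn G v C) (h2 : MixedOn G v D) : False := by
  obtain ⟨c, hc, c', hc', hvc, hvc', hne, hcc⟩ := h1.exists_not_adj hC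
  obtain ⟨d, hd, d', hd', hvd, hvd', hne', hdd⟩ := h2.exists_not_adj hD
  have a1 := hcomp c hc d hd
  have a2 := hcomp c hc d' hd'
  have a3 := hcomp c' hc' d hd
  have a4 := hcomp c' hc' d' hd'
  have b1 : v ≠ c := fun h => hvC (h ▸ hc)
  have b2 : v ≠ c' := fun h => hvC (h ▸ hc')
  have b3 : v ≠ d := fun h => hvD (h ▸ hd)
  have b4 : v ≠ d' := fun h => hvD (h ▸ hd')
  let g : ℕ → V := fun a => if a = 0 then c else if a = 1 then d else if a = 2 then c' else d'
  refine hG (HasHoleWithHat.of_nat (N := 4) (t := 0) le_rfl (by omega) g v ?_ ?_ ?_ ?_)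
  · intro a b hab hb
    interval_cases b <;> interval_cases a <;>
      simp [g, hne, hne', a1.ne, a2.ne, a3.ne', a4.ne]
  · intro a b hab hb
    interval_cases b <;> interval_cases a <;>
      simp [g, hcc, hdd, a1, a2, a3.symm, a4]
  · intro a ha
    interval_cases a <;> simp [g, b1, b2, b3, b4]
  · intro a ha
    interval_cases a <;> simp [g, hvc, hvc', hvd, hvd']

/-- A walk `f 0, …, f n` outside `C ∪ D` from a vertex mixed on `C` to a vertex mixed on `D`,
whose first part has no vertex complete to `C` and whose last part, sharing the vertex `f k`
with the first, has no vertex complete to `D`. -/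
structure MixedWalk (G : SimpleGraph V) (C D : Set V) (n k : ℕ) (f : ℕ → V) : Prop where
  comp : CompleteTo G C D
  connC : ConnSet G C
  antiC : AnticonnSet G C
  connD : ConnSet G D
  antiD : AnticonnSet G D
  le : k ≤ n
  adj : ∀ i, i < n → G.Adj (f i) (f (i + 1))
  notMemC : ∀ i, i ≤ n → f i ∉ C
  notMemD : ∀ i, i ≤ n → f i ∉ D
  mixedC : MixedOn G (f 0) C
  mixedD : MixedOn G (f n) D
  notCompC : ∀ i, i ≤ k → ¬ VertCompleteTo G (f i) C
  notCompD : ∀ i, k ≤ i → i ≤ n → ¬ VertCompleteTo G (f i) D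

namespace MixedWalk

variable {G : SimpleGraph V} {C D : Set V} {n k : ℕ} {f : ℕ → V}

lemma reverse (h : MixedWalk G C D n k f) :
    MixedWalk G D C n (n - k) (fun i => f (n - i)) where
  comp d hd c hc := (h.comp c hc d hd).symm
  connC := h.connD
  antiC := h.antiD
  connD := h.connC
  antiD := h.antiC
  le := Nat.sub_le _ _
  adj i hi := by
    have h1 := h.adj (n - (i + 1)) (by omega)
    rw [show n - (i + 1) + 1 = n - i by omega] at h1
    exact h1.symm
  notMemC i _ := h.notMemD _ (by omega)
  notMemD i _ := h.notMemC _ (by omega)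
  mixedC := by simpa using h.mixedD
  mixedD := by simpa using h.mixedC
  notCompC i hi := by
    have := h.le
    exact h.notCompD _ (by omega) (by omega)
  notCompD i hi hin := h.notCompC _ (by omega)

lemma drop (h : MixedWalk G C D n k f) {i : ℕ} (hi : i ≤ n) (hmix : MixedOn G (f i) C) :
    MixedWalk G C D (n - i) (k - i) (fun j => f (i + j)) where
  comp := h.comp
  connC := h.connC
  antiC := h.antiC
  connD := h.connD
  antiD := h.antiD
  le := Nat.sub_le_sub_right h.le _
  adj j hj := h.adj (i + j) (by omega)
  notMemC j hj := h.notMemC _ (by omega)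
  notMemD j hj := h.notMemD _ (by omega)
  mixedC := hmix
  mixedD := by
    rw [Nat.add_sub_cancel' hi]
    exact h.mixedD
  notCompC j hj := by
    rcases Nat.eq_zero_or_pos j with rfl | hj0
    · obtain ⟨c, hc, hn⟩ := hmix.2
      exact fun hh => hn (hh c hc)
    · exact h.notCompC _ (by omega)
  notCompD j hj hjn := h.notCompD _ (by omega) (by omega)

lemma shortcut (h : MixedWalk G C D n k f) {a b : ℕ} (hka : k ≤ a) (hab : a + 1 < b)
    (hb : b ≤ n) (hadj : G.Adj (f a) (f b)) :
    MixedWalk G C D (n - (b - a - 1)) k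
      (fun i => if i ≤ a then f i else f (i + (b - a - 1))) where
  comp := h.comp
  connC := h.connC
  antiC := h.antiC
  connD := h.connD
  antiD := h.antiD
  le := by omega
  adj i hi := by
    rcases lt_trichotomy i a with hia | rfl | hia
    · simp only [show i ≤ a by omega, show i + 1 ≤ a by omega, if_true]
      exact h.adj i (by omega)
    · simp only [le_refl, show ¬ i + 1 ≤ i by omega, if_true, if_false,
        show i + 1 + (b - i - 1) = b by omega]
      exact hadj
    · simp only [show ¬ i ≤ a by omega, show ¬ i + 1 ≤ a by omega, if_false,
        show i + 1 + (b - a - 1) = i + (b - a - 1) + 1 by omega]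
      exact h.adj _ (by omega)
  notMemC i hi := by
    split_ifs
    · exact h.notMemC _ (by omega)
    · exact h.notMemC _ (by omega)
  notMemD i hi := by
    split_ifs
    · exact h.notMemD _ (by omega)
    · exact h.notMemD _ (by omega)
  mixedC := by simpa using h.mixedC
  mixedD := by
    rw [if_neg (by omega), show n - (b - a - 1) + (b - a - 1) = n by omega]
    exact h.mixedD
  notCompC i hi := by
    rw [if_pos (by omega)]
    exact h.notCompC i hi
  notCompD i hi hin := by
    split_ifs
    · exact h.notCompD _ (by omega) (by omega)
    · exact h.notCompD _ (by omega) (by omega)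

/-- If the first vertex of the walk is complete to `D`, it can be moved into `C`. -/
lemma absorb (h : MixedWalk G C D n k f) (hk : 0 < k)
    (hne : ∀ i, 0 < i → i ≤ n → f i ≠ f 0) (hD : VertCompleteTo G (f 0) D) :
    MixedWalk G (insert (f 0) C) D (n - 1) (k - 1) (fun i => f (i + 1)) where
  comp c hc d hd := by
    rcases hc with rfl | hc
    · exact hD d hd
    · exact h.comp c hc d hd
  connC := by
    obtain ⟨c, hc, hadj⟩ := h.mixedC.1
    exact h.connC.insert hc hadj
  antiC := by
    obtain ⟨c, hc, hadj⟩ := h.mixedC.2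
    have hfc : f 0 ≠ c := fun hh => h.notMemC 0 (Nat.zero_le _) (hh ▸ hc)
    exact anticonnSet_iff.2 ((anticonnSet_iff.1 h.antiC).insert hc
      ((SimpleGraph.compl_adj _ _ _).2 ⟨hfc, hadj⟩))
  connD := h.connD
  antiD := h.antiD
  le := Nat.sub_le_sub_right h.le _
  adj i hi := h.adj _ (by omega)
  notMemC i hi := by
    have := h.le
    rintro (hh | hh)
    · exact hne _ (by omega) (by omega) hh
    · exact h.notMemC _ (by omega) hh
  notMemD i hi := by
    have := h.le
    exact h.notMemD _ (by omega)
  mixedC := by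
    have := h.le
    exact MixedOn.of_adj (Set.mem_insert _ _) (h.adj 0 (by omega)).symm
      fun hh => h.notCompC 1 hk fun c hc => hh c (Set.mem_insert_of_mem _ hc)
  mixedD := by
    have := h.le
    rw [show n - 1 + 1 = n by omega]
    exact h.mixedD
  notCompC i hi hh :=
    h.notCompC (i + 1) (by omega) fun c hc => hh c (Set.mem_insert_of_mem _ hc)
  notCompD i hi hin := by
    have := h.le
    exact h.notCompD _ (by omega) (by omega)

/-- No strictly shorter mixed walk exists, for any pair of sets. -/
def Shortest (G : SimpleGraph V) (n : ℕ) : Prop :=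
  ∀ (m : ℕ) (C D : Set V) (k : ℕ) (f : ℕ → V), m < n → ¬ MixedWalk G C D m k f

lemma pos (hG : HoleWithHatFree G) (h : MixedWalk G C D n k f) : 0 < n := by
  rcases Nat.eq_zero_or_pos n with rfl | hn
  · exact (hG.not_mixedOn_both h.comp h.antiC h.antiD (h.notMemC 0 le_rfl)
      (h.notMemD 0 le_rfl) h.mixedC h.mixedD).elim
  · exact hn

lemma not_mixedC (h : MixedWalk G C D n k f) (hmin : Shortest G n) {i : ℕ} (hi : 0 < i)
    (hin : i ≤ n) : ¬ MixedOn G (f i) C :=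
  fun hmix => hmin _ _ _ _ _ (by omega) (h.drop hin hmix)

lemma head_anticomplete (hG : HoleWithHatFree G) (h : MixedWalk G C D n k f)
    (hmin : Shortest G n) : ∀ d ∈ D, ¬ G.Adj (f 0) d := by
  intro d hd hadj
  have hnc : ¬ VertCompleteTo G (f 0) D := by
    intro hD
    rcases Nat.eq_zero_or_pos k with rfl | hk
    · exact h.notCompD 0 le_rfl (Nat.zero_le _) hD
    · refine hmin _ _ _ _ _ (Nat.sub_lt (h.pos hG) one_pos) (h.absorb hk ?_ hD)
      intro i hi hin heq
      exact h.not_mixedC hmin hi hin (heq ▸ h.mixedC)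
  exact hG.not_mixedOn_both h.comp h.antiC h.antiD (h.notMemC 0 (Nat.zero_le _))
    (h.notMemD 0 (Nat.zero_le _)) h.mixedC (MixedOn.of_adj hd hadj hnc)

lemma last_anticomplete (hG : HoleWithHatFree G) (h : MixedWalk G C D n k f)
    (hmin : Shortest G n) : ∀ c ∈ C, ¬ G.Adj (f n) c := by
  simpa using h.reverse.head_anticomplete hG hmin

lemma not_mixedD (h : MixedWalk G C D n k f) (hmin : Shortest G n) {i : ℕ} (hin : i < n) :
    ¬ MixedOn G (f i) D := by
  have := h.reverse.not_mixedC hmin (i := n - i) (by omega) (by omega)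
  rwa [show n - (n - i) = i by omega] at this

/-- In a shortest mixed walk, the last vertex with a neighbour in `C` does not occur, before the
end, in the part without vertices complete to `D`. -/
lemma no_last_neighbor (hG : HoleWithHatFree G) (h : MixedWalk G C D n k f)
    (hmin : Shortest G n) {i : ℕ} (hki : k ≤ i) (hin : i < n) {c : V} (hc : c ∈ C)
    (hadj : G.Adj (f i) c) (hlast : ∀ j, i < j → j ≤ n → ∀ c ∈ C, ¬ G.Adj (f j) c) : False := by
  obtain ⟨d, hd, e, he, hnd, hne, hde⟩ := h.mixedD.exists_adj_s8 h.connD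
  have hanti : ∀ j, i ≤ j → j < n → ∀ d ∈ D, ¬ G.Adj (f j) d := fun j hij hj d hd hh =>
    h.not_mixedD hmin hj (MixedOn.of_adj hd hh (h.notCompD j (by omega) hj.le))
  refine hG (HasHoleWithHat.of_path (m := n - i) (by omega) (fun a => f (i + a)) c d e
    (h.comp c hc d hd) (h.comp c hc e he) hde ?_ ?_ ?_ ?_)
  · intro a b hab hb
    constructor
    · intro hh
      by_contra hne
      exact hmin _ _ _ _ _ (by omega)
        (h.shortcut (a := i + a) (b := i + b) (by omega) (by omega) (by omega) hh)
    · rintro rfl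
      exact h.adj _ (by omega)
  · intro a ha
    constructor
    · intro hh
      by_contra hne
      exact hlast (i + a) (by omega) (by omega) c hc hh.symm
    · rintro rfl
      exact hadj.symm
  · intro a ha
    constructor
    · intro hh
      by_contra hne
      exact hanti (i + a) (by omega) (by omega) d hd hh.symm
    · rintro rfl
      rw [Nat.add_sub_cancel' hin.le]
      exact hnd.symm
  · intro a ha hh
    rcases Nat.lt_or_ge (i + a) n with hlt | hge
    · exact hanti (i + a) (by omega) hlt e he hh.symm
    · rw [show i + a = n by omega] at hh
      exact hne hh.symm

lemma anticompleteC (hG : HoleWithHatFree G) (h : MixedWalk G C D n k f)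
    (hmin : Shortest G n) {i : ℕ} (hi : 0 < i) (hin : i ≤ n) : ∀ c ∈ C, ¬ G.Adj (f i) c := by
  induction hm : n - i using Nat.strong_induction_on generalizing i with
  | _ m ih =>
    intro c hc hadj
    have hcomp : VertCompleteTo G (f i) C := by
      by_contra hh
      exact h.not_mixedC hmin hi hin (MixedOn.of_adj hc hadj hh)
    have hki : k < i := by
      by_contra hh
      exact h.notCompC i (by omega) hcomp
    have hin' : i < n := by
      rcases hin.lt_or_eq with hlt | rfl
      · exact hlt
      · exact (h.last_anticomplete hG hmin c hc hadj).elim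
    exact h.no_last_neighbor hG hmin hki.le hin' hc hadj
      fun j hij hj => ih (n - j) (by omega) (by omega) hj rfl

lemma anticompleteD (hG : HoleWithHatFree G) (h : MixedWalk G C D n k f)
    (hmin : Shortest G n) {i : ℕ} (hin : i < n) : ∀ d ∈ D, ¬ G.Adj (f i) d := by
  have := h.reverse.anticompleteC hG hmin (i := n - i) (by omega) (by omega)
  rwa [show n - (n - i) = i by omega] at this

lemma with_zero (hG : HoleWithHatFree G) (h : MixedWalk G C D n k f) (hmin : Shortest G n) :
    MixedWalk G C D n 0 f where
  __ := h
  le := Nat.zero_le _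
  notCompC i hi := h.notCompC i (by omega)
  notCompD i _ hin hD := by
    rcases hin.lt_or_eq with hlt | rfl
    · obtain ⟨d, hd, -⟩ := h.mixedD.1
      exact h.anticompleteD hG hmin hlt d hd (hD d hd)
    · exact h.notCompD i h.le le_rfl hD

end MixedWalk

lemma HoleWithHatFree.not_mixedWalk {G : SimpleGraph V} (hG : HoleWithHatFree G) (n : ℕ) :
    ∀ (C D : Set V) (k : ℕ) (f : ℕ → V), ¬ MixedWalk G C D n k f := by
  induction n using Nat.strong_induction_on with
  | _ n ih =>
    intro C D k f h
    have hmin : MixedWalk.Shortest G n := fun m C D k f hm => ih m hm C D k f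
    obtain ⟨c, hc, hadj⟩ := h.mixedC.1
    exact (h.with_zero hG hmin).no_last_neighbor hG hmin le_rfl (h.pos hG) hc hadj
      fun j hj hjn => h.anticompleteC hG hmin hj hjn

theorem statement_8 {V : Type} [Fintype V] (G : SimpleGraph V)
    (hG : HoleWithHatFree G) (C D : Set V) (hCne : C.Nonempty) (hDne : D.Nonempty)
    (hdisj : Disjoint C D) (hcomp : CompleteTo G C D)
    (hCconn : ConnSet G C) (hCanti : AnticonnSet G C)
    (hDconn : ConnSet G D) (hDanti : AnticonnSet G D) :
    ¬ ∃ P Q : Set V, P ⊆ (C ∪ D)ᶜ ∧ Q ⊆ (C ∪ D)ᶜ ∧ ConnSet G P ∧ ConnSet G Q ∧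
      (P ∩ Q).Nonempty ∧
      (∃ p ∈ P, ∃ c ∈ C, G.Adj p c) ∧ (∀ p ∈ P, ¬ VertCompleteTo G p C) ∧
      (∃ q ∈ Q, ∃ d ∈ D, G.Adj q d) ∧ (∀ q ∈ Q, ¬ VertCompleteTo G q D) := by
  rintro ⟨P, Q, hP, hQ, hPconn, hQconn, ⟨x, hxP, hxQ⟩, ⟨p, hp, c, hc, hpc⟩, hPC,
    ⟨q, hq, d, hd, hqd⟩, hQD⟩
  obtain ⟨k, g, hg0, hgk, hgP, hgadj⟩ := hPconn.exists_seq hp hxP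
  obtain ⟨l, r, hr0, hrl, hrQ, hradj⟩ := hQconn.exists_seq hxQ hq
  have hmem : ∀ i, (if i ≤ k then g i else r (i - k)) ∈ (C ∪ D)ᶜ := by
    intro i
    split_ifs
    · exact hP (hgP _)
    · exact hQ (hrQ _)
  have hr : ∀ i, k ≤ i → (if i ≤ k then g i else r (i - k)) = r (i - k) := by
    intro i hi
    split_ifs with h
    · rw [show i = k by omega, hgk, Nat.sub_self, hr0]
    · rfl
  refine hG.not_mixedWalk (k + l) C D k (fun i => if i ≤ k then g i else r (i - k))
    { comp := hcomp
      connC := hCconn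
      antiC := hCanti
      connD := hDconn
      antiD := hDanti
      le := Nat.le_add_right _ _
      adj := ?_
      notMemC := fun i _ h => hmem i (Or.inl h)
      notMemD := fun i _ h => hmem i (Or.inr h)
      mixedC := ?_
      mixedD := ?_
      notCompC := ?_
      notCompD := ?_ }
  · intro i hi
    rcases Nat.lt_or_ge i k with h | h
    · simp only [h.le, Nat.succ_le_of_lt h, if_true]
      exact hgadj i h
    · rw [hr i h, hr (i + 1) (by omega), show i + 1 - k = i - k + 1 by omega]
      exact hradj _ (by omega)
  · simp only [Nat.zero_le, if_true, hg0]
    exact MixedOn.of_adj hc hpc (hPC p hp)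
  · rw [hr _ (by omega), Nat.add_sub_cancel_left, hrl]
    exact MixedOn.of_adj hd hqd (hQD q hq)
  · intro i hi
    simp only [hi, if_true]
    exact hPC _ (hgP _)
  · intro i hi _
    rw [hr i hi]
    exact hQD _ (hrQ _)

end EHhat
end
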